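/- Fix r > 0 and ε ∈ (−1,0). On the open simplex Δ = {(z₁,z₂,z₃) ∈ (0,∞)³ : z₁+z₂+z₃ < 1}, with z₄ := 1−z₁−z₂−z₃ and F := r·z₁z₃ + z₂z₄ > 0, the functions z₁z₃·F^{−(3+ε)}, z₁²z₃·F^{−(3+ε)} and z₁z₂z₃·F^{−(3+ε)} are Lebesgue integrable on Δ, and ∫_Δ z₁z₃ F^{−(3+ε)} = 2·∫_Δ z₁²z₃ F^{−(3+ε)} + 2·∫_Δ z₁z₂z₃ F^{−(3+ε)}. -/

import Mathlib

open MeasureTheory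

noncomputable section

/-- The open simplex `Δ = {(z₁,z₂,z₃) ∈ (0,∞)³ : z₁+z₂+z₃ < 1}`. -/
def boxDelta : Set (ℝ × ℝ × ℝ) :=
  {z | 0 < z.1 ∧ 0 < z.2.1 ∧ 0 < z.2.2 ∧ z.1 + z.2.1 + z.2.2 < 1}

/-- The fourth Feynman parameter `z₄ = 1 − z₁ − z₂ − z₃`. -/
def boxZ4 (z : ℝ × ℝ × ℝ) : ℝ := 1 - z.1 - z.2.1 - z.2.2

/-- The second Symanzik polynomial of the massless box, `F = r z₁ z₃ + z₂ z₄`. -/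
def boxF (r : ℝ) (z : ℝ × ℝ × ℝ) : ℝ := r * z.1 * z.2.2 + z.2.1 * boxZ4 z

end

section BoxSymmetries

/-- The exchange `z₁ ↔ z₂`. -/
def swapFirstSecond (z : ℝ × ℝ × ℝ) : ℝ × ℝ × ℝ := (z.2.1, z.1, z.2.2)

/-- The exchange `z₁ ↔ z₃`. -/
def swapFirstThird (z : ℝ × ℝ × ℝ) : ℝ × ℝ × ℝ := (z.2.2, z.2.1, z.1)

/-- The exchange `z₂ ↔ z₄`. -/
def swapSecondFourth (z : ℝ × ℝ × ℝ) : ℝ × ℝ × ℝ := (z.1, boxZ4 z, z.2.2)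

lemma measurable_boxZ4 : Measurable boxZ4 := by
  unfold boxZ4; fun_prop

lemma measurable_boxF (r : ℝ) : Measurable (boxF r) := by
  have := measurable_boxZ4
  unfold boxF; fun_prop

lemma measurableSet_boxDelta : MeasurableSet boxDelta := by
  have h : ∀ f g : ℝ × ℝ × ℝ → ℝ, Measurable f → Measurable g → MeasurableSet {z | f z < g z} :=
    fun _ _ => measurableSet_lt
  exact (h (fun _ => 0) (fun z => z.1) (by fun_prop) (by fun_prop)).inter
    ((h (fun _ => 0) (fun z => z.2.1) (by fun_prop) (by fun_prop)).inter
      ((h (fun _ => 0) (fun z => z.2.2) (by fun_prop) (by fun_prop)).inter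
        (h (fun z => z.1 + z.2.1 + z.2.2) (fun _ => 1) (by fun_prop) (by fun_prop))))

lemma measurePreserving_swapFirstSecond : MeasurePreserving swapFirstSecond := by
  have h1 := measurePreserving_prodAssoc (volume : Measure ℝ) (volume : Measure ℝ)
    (volume : Measure ℝ)
  have h2 : MeasurePreserving (Prod.map Prod.swap id : (ℝ × ℝ) × ℝ → (ℝ × ℝ) × ℝ)
      ((volume.prod volume).prod volume) ((volume.prod volume).prod volume) :=
    Measure.measurePreserving_swap.prod (MeasurePreserving.id _)
  exact h1.comp (h2.comp (h1.symm _))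

lemma measurePreserving_swapFirstThird : MeasurePreserving swapFirstThird := by
  have h : MeasurePreserving (Prod.map id Prod.swap : ℝ × ℝ × ℝ → ℝ × ℝ × ℝ)
      (volume.prod (volume.prod volume)) (volume.prod (volume.prod volume)) :=
    (MeasurePreserving.id _).prod Measure.measurePreserving_swap
  exact measurePreserving_swapFirstSecond.comp (h.comp measurePreserving_swapFirstSecond)

lemma measurePreserving_reflect_first (a : ℝ) :
    MeasurePreserving (fun p : ℝ × ℝ => (a - p.1 - p.2, p.2)) := by
  have h : MeasurePreserving (fun p : ℝ × ℝ => (p.1, (a - p.1) - p.2))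
      (volume.prod volume) (volume.prod volume) :=
    (MeasurePreserving.id volume).skew_product (g := fun x y => (a - x) - y) (by fun_prop)
      (Filter.Eventually.of_forall fun x => (Measure.measurePreserving_sub_left volume (a - x)).map_eq)
  have h' := Measure.measurePreserving_swap.comp (h.comp Measure.measurePreserving_swap)
  have e : (fun p : ℝ × ℝ => (a - p.1 - p.2, p.2)) =
      Prod.swap ∘ (fun p : ℝ × ℝ => (p.1, (a - p.1) - p.2)) ∘ Prod.swap := by
    funext p
    exact Prod.ext (sub_right_comm a p.1 p.2) rfl
  rw [e]
  exact h'

lemma measurePreserving_swapSecondFourth : MeasurePreserving swapSecondFourth :=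
  (MeasurePreserving.id volume).skew_product
    (g := fun x (p : ℝ × ℝ) => ((1 - x) - p.1 - p.2, p.2)) (by fun_prop)
    (Filter.Eventually.of_forall fun x => (measurePreserving_reflect_first (1 - x)).map_eq)

lemma involutive_swapFirstSecond : Function.Involutive swapFirstSecond := fun _ => rfl

lemma involutive_swapFirstThird : Function.Involutive swapFirstThird := fun _ => rfl

lemma boxZ4_swapSecondFourth (z : ℝ × ℝ × ℝ) : boxZ4 (swapSecondFourth z) = z.2.1 := by
  simp only [boxZ4, swapSecondFourth]; ring

lemma involutive_swapSecondFourth : Function.Involutive swapSecondFourth := fun z => by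
  ext
  · rfl
  · exact boxZ4_swapSecondFourth z
  · rfl

lemma measurableEmbedding_of_involutive {α : Type*} [MeasurableSpace α] {σ : α → α}
    (hσ : Function.Involutive σ) (hm : Measurable σ) : MeasurableEmbedding σ :=
  (MeasurableEquiv.ofInvolutive σ hσ hm).measurableEmbedding

lemma preimage_swapFirstSecond : swapFirstSecond ⁻¹' boxDelta = boxDelta := by
  ext z
  simp only [boxDelta, swapFirstSecond, Set.mem_preimage, Set.mem_ofPred_eq]
  constructor <;> rintro ⟨h1, h2, h3, h4⟩ <;> refine ⟨?_, ?_, ?_, ?_⟩ <;> linarith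

lemma preimage_swapFirstThird : swapFirstThird ⁻¹' boxDelta = boxDelta := by
  ext z
  simp only [boxDelta, swapFirstThird, Set.mem_preimage, Set.mem_ofPred_eq]
  constructor <;> rintro ⟨h1, h2, h3, h4⟩ <;> refine ⟨?_, ?_, ?_, ?_⟩ <;> linarith

lemma preimage_swapSecondFourth : swapSecondFourth ⁻¹' boxDelta = boxDelta := by
  ext z
  simp only [boxDelta, swapSecondFourth, boxZ4, Set.mem_preimage, Set.mem_ofPred_eq]
  constructor <;> rintro ⟨h1, h2, h3, h4⟩ <;> refine ⟨?_, ?_, ?_, ?_⟩ <;> linarith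

lemma integrableOn_comp_of_involutive {α : Type*} [MeasurableSpace α] {μ : Measure α}
    {σ : α → α} {s : Set α} {f : α → ℝ} (hσ : Function.Involutive σ)
    (hm : MeasurePreserving σ μ μ) (hs : σ ⁻¹' s = s) (hf : IntegrableOn f s μ) :
    IntegrableOn (fun x => f (σ x)) s μ := by
  have h := (hm.integrableOn_comp_preimage
    (measurableEmbedding_of_involutive hσ hm.measurable) (f := f) (s := s)).2 hf
  rwa [hs] at h

lemma setIntegral_comp_of_involutive {α : Type*} [MeasurableSpace α] {μ : Measure α}
    {σ : α → α} {s : Set α} (hσ : Function.Involutive σ)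
    (hm : MeasurePreserving σ μ μ) (hs : σ ⁻¹' s = s) (f : α → ℝ) :
    ∫ x in s, f (σ x) ∂μ = ∫ x in s, f x ∂μ := by
  have h := hm.setIntegral_preimage_emb
    (measurableEmbedding_of_involutive hσ hm.measurable) f s
  rwa [hs] at h

end BoxSymmetries

lemma boxZ4_pos {z : ℝ × ℝ × ℝ} (hz : z ∈ boxDelta) : 0 < boxZ4 z := by
  obtain ⟨-, -, -, h⟩ := hz
  unfold boxZ4; linarith

lemma mul_rpow_le_of_sum_eq_one {a b c d β : ℝ} (ha : 0 < a) (hb : 0 < b) (hc : 0 < c)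
    (hd : 0 < d) (h : a + b + c + d = 1) (hβ : β ≤ 0) :
    a ^ β * b ^ β * c ^ β * d ^ β ≤ (1 / 4 : ℝ) ^ β *
      (a ^ β * (b ^ β * c ^ β) + a ^ β * (d ^ β * c ^ β) + b ^ β * (d ^ β * c ^ β)
        + b ^ β * (d ^ β * a ^ β)) := by
  have key : ∀ x : ℝ, 1 / 4 ≤ x → x ^ β ≤ (1 / 4 : ℝ) ^ β := fun x hx =>
    Real.rpow_le_rpow_of_nonpos (by norm_num) hx hβ
  have hA := key a
  have hB := key b
  have hC := key c
  have hD := key d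
  have pa := Real.rpow_pos_of_pos ha β
  have pb := Real.rpow_pos_of_pos hb β
  have pc := Real.rpow_pos_of_pos hc β
  have pd := Real.rpow_pos_of_pos hd β
  have pk : 0 < (1 / 4 : ℝ) ^ β := Real.rpow_pos_of_pos (by norm_num) β
  generalize a ^ β = A at *
  generalize b ^ β = B at *
  generalize c ^ β = C at *
  generalize d ^ β = D at *
  generalize (1 / 4 : ℝ) ^ β = K at *
  have e1 : 0 < K * (A * (B * C)) := by positivity
  have e2 : 0 < K * (A * (D * C)) := by positivity
  have e3 : 0 < K * (B * (D * C)) := by positivity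
  have e4 : 0 < K * (B * (D * A)) := by positivity
  have hmax : 1 / 4 ≤ a ∨ 1 / 4 ≤ b ∨ 1 / 4 ≤ c ∨ 1 / 4 ≤ d := by
    by_contra! hlt
    linarith [hlt.1, hlt.2.1, hlt.2.2.1, hlt.2.2.2]
  rcases hmax with hx | hx | hx | hx
  · linarith [mul_le_mul_of_nonneg_right (hA hx) (by positivity : 0 ≤ B * (D * C))]
  · linarith [mul_le_mul_of_nonneg_right (hB hx) (by positivity : 0 ≤ A * (D * C))]
  · linarith [mul_le_mul_of_nonneg_right (hC hx) (by positivity : 0 ≤ B * (D * A))]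
  · linarith [mul_le_mul_of_nonneg_right (hD hx) (by positivity : 0 ≤ A * (B * C))]

lemma integrableOn_boxDelta_rpow_three {β : ℝ} (hβ : -1 < β) :
    IntegrableOn (fun z : ℝ × ℝ × ℝ => z.1 ^ β * (z.2.1 ^ β * z.2.2 ^ β)) boxDelta := by
  have h1 : IntegrableOn (fun x : ℝ => x ^ β) (Set.Ioc 0 1) :=
    (intervalIntegrable_iff_integrableOn_Ioc_of_le zero_le_one).1
      (intervalIntegral.intervalIntegrable_rpow' hβ)
  have h3 : Integrable (fun z : ℝ × ℝ × ℝ => z.1 ^ β * (z.2.1 ^ β * z.2.2 ^ β))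
      ((volume.restrict (Set.Ioc 0 1)).prod
        ((volume.restrict (Set.Ioc 0 1)).prod (volume.restrict (Set.Ioc 0 1)))) :=
    Integrable.mul_prod h1 (Integrable.mul_prod h1 h1)
  rw [Measure.prod_restrict, Measure.prod_restrict] at h3
  refine IntegrableOn.mono_set (t := Set.Ioc 0 1 ×ˢ Set.Ioc 0 1 ×ˢ Set.Ioc 0 1) h3 ?_
  rintro z ⟨h1, h2, h3, h4⟩
  refine ⟨⟨h1, ?_⟩, ⟨h2, ?_⟩, ⟨h3, ?_⟩⟩ <;> linarith

/-- Convergence of the Dirichlet integral with all four exponents equal. -/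
lemma integrableOn_boxDelta_rpow_four {β : ℝ} (hβ : -1 < β) (hβ' : β ≤ 0) :
    IntegrableOn (fun z : ℝ × ℝ × ℝ => z.1 ^ β * z.2.1 ^ β * z.2.2 ^ β * boxZ4 z ^ β)
      boxDelta := by
  have i4 := integrableOn_boxDelta_rpow_three hβ
  have i2 := integrableOn_comp_of_involutive involutive_swapSecondFourth
    measurePreserving_swapSecondFourth preimage_swapSecondFourth i4
  have i1 := integrableOn_comp_of_involutive involutive_swapFirstSecond
    measurePreserving_swapFirstSecond preimage_swapFirstSecond i2
  have i3 := integrableOn_comp_of_involutive involutive_swapFirstThird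
    measurePreserving_swapFirstThird preimage_swapFirstThird i1
  have hm := measurable_boxZ4
  refine Integrable.mono' ((((i4.add i2).add i1).add i3).const_mul ((1 / 4 : ℝ) ^ β))
    (by fun_prop) ?_
  refine (ae_restrict_iff' measurableSet_boxDelta).2 (Filter.Eventually.of_forall fun z hz => ?_)
  have h4 := boxZ4_pos hz
  have hsum : z.1 + z.2.1 + z.2.2 + boxZ4 z = 1 := by unfold boxZ4; ring
  obtain ⟨h1, h2, h3, -⟩ := hz
  rw [Real.norm_of_nonneg (by positivity)]
  refine (mul_rpow_le_of_sum_eq_one h1 h2 h3 h4 hsum hβ').trans_eq ?_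
  have e1 : boxZ4 (swapFirstSecond z) = boxZ4 z := by
    simp only [boxZ4, swapFirstSecond]; ring
  have e2 : boxZ4 (swapFirstSecond (swapFirstThird z)) = boxZ4 z := by
    simp only [boxZ4, swapFirstSecond, swapFirstThird]; ring
  simp only [Pi.add_apply, swapSecondFourth, e1, e2]
  simp only [swapFirstSecond, swapFirstThird]

lemma integrableOn_box_numerator {r ε : ℝ} (hr : 0 < r) (hε : ε ∈ Set.Ioo (-1 : ℝ) 0) :
    IntegrableOn (fun z => z.1 * z.2.2 * boxF r z ^ (-(3 + ε))) boxDelta := by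
  obtain ⟨hε1, hε0⟩ := hε
  have hF := measurable_boxF r
  refine Integrable.mono' ((integrableOn_boxDelta_rpow_four (β := -1 - ε / 2)
    (by linarith) (by linarith)).const_mul (r ^ (-2 - ε / 2))) (by fun_prop) ?_
  refine (ae_restrict_iff' measurableSet_boxDelta).2 (Filter.Eventually.of_forall fun z hz => ?_)
  have h4 := boxZ4_pos hz
  obtain ⟨h1, h2, h3, -⟩ := hz
  have p13 : 0 < r * z.1 * z.2.2 := by positivity
  have p24 : 0 < z.2.1 * boxZ4 z := by positivity
  have pF : 0 < boxF r z := add_pos p13 p24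
  rw [Real.norm_of_nonneg (by positivity)]
  have b1 : boxF r z ^ (-2 - ε / 2) ≤ (r * z.1 * z.2.2) ^ (-2 - ε / 2) :=
    Real.rpow_le_rpow_of_nonpos p13 (by unfold boxF; linarith) (by linarith)
  have b2 : boxF r z ^ (-1 - ε / 2) ≤ (z.2.1 * boxZ4 z) ^ (-1 - ε / 2) :=
    Real.rpow_le_rpow_of_nonpos p24 (by unfold boxF; linarith) (by linarith)
  have split : ∀ x : ℝ, 0 < x → x * x ^ (-2 - ε / 2) = x ^ (-1 - ε / 2) := fun x hx => by
    rw [← Real.rpow_one_add' hx.le (by linarith)]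
    ring_nf
  calc z.1 * z.2.2 * boxF r z ^ (-(3 + ε))
      = z.1 * z.2.2 * (boxF r z ^ (-2 - ε / 2) * boxF r z ^ (-1 - ε / 2)) := by
        rw [← Real.rpow_add pF]; ring_nf
    _ ≤ z.1 * z.2.2 * ((r * z.1 * z.2.2) ^ (-2 - ε / 2)
          * (z.2.1 * boxZ4 z) ^ (-1 - ε / 2)) := by gcongr
    _ = _ := by
        rw [Real.mul_rpow (by positivity) h3.le, Real.mul_rpow hr.le h1.le,
          Real.mul_rpow h2.le h4.le, ← split _ h1, ← split _ h3]
        ring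

lemma integrableOn_mul_of_mem_Icc {α : Type*} [MeasurableSpace α] {μ : Measure α} {s : Set α}
    {f g : α → ℝ} (hs : MeasurableSet s) (hf : IntegrableOn f s μ) (hg : Measurable g)
    (h : ∀ x ∈ s, g x ∈ Set.Icc 0 1) : IntegrableOn (fun x => g x * f x) s μ := by
  refine hf.bdd_mul (c := 1) hg.aestronglyMeasurable ?_
  refine (ae_restrict_iff' hs).2 (Filter.Eventually.of_forall fun x hx => ?_)
  rw [Real.norm_of_nonneg (h x hx).1]
  exact (h x hx).2

/-- Projective sum rule `I(2,1,2,1;2ε) = 2 I(3,1,2,1;−1+2ε) + 2 I(2,2,2,1;−1+2ε)`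
for the one-loop massless box, in Feynman parameter space. -/
theorem box_sum_rule (r ε : ℝ) (hr : 0 < r) (hε : ε ∈ Set.Ioo (-1 : ℝ) 0) :
    IntegrableOn (fun z => z.1 * z.2.2 * boxF r z ^ (-(3 + ε))) boxDelta volume ∧
    IntegrableOn (fun z => z.1 ^ 2 * z.2.2 * boxF r z ^ (-(3 + ε))) boxDelta volume ∧
    IntegrableOn (fun z => z.1 * z.2.1 * z.2.2 * boxF r z ^ (-(3 + ε))) boxDelta volume ∧
    ∫ z in boxDelta, z.1 * z.2.2 * boxF r z ^ (-(3 + ε)) =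
      2 * (∫ z in boxDelta, z.1 ^ 2 * z.2.2 * boxF r z ^ (-(3 + ε)))
        + 2 * ∫ z in boxDelta, z.1 * z.2.1 * z.2.2 * boxF r z ^ (-(3 + ε)) := by
  set f : ℝ × ℝ × ℝ → ℝ := fun z => z.1 * z.2.2 * boxF r z ^ (-(3 + ε)) with hf
  have i0 : IntegrableOn f boxDelta := integrableOn_box_numerator hr hε
  have i1 : IntegrableOn (fun z => z.1 * f z) boxDelta :=
    integrableOn_mul_of_mem_Icc measurableSet_boxDelta i0 (by fun_prop)
      fun z ⟨h1, h2, h3, h4⟩ => ⟨h1.le, by linarith⟩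
  have i2 : IntegrableOn (fun z => z.2.1 * f z) boxDelta :=
    integrableOn_mul_of_mem_Icc measurableSet_boxDelta i0 (by fun_prop)
      fun z ⟨h1, h2, h3, h4⟩ => ⟨h2.le, by linarith⟩
  have f13 : ∀ z, f (swapFirstThird z) = f z := fun z => by
    have : boxF r (swapFirstThird z) = boxF r z := by
      simp only [boxF, boxZ4, swapFirstThird]; ring
    simp only [hf, this]
    simp only [swapFirstThird]; ring
  have f24 : ∀ z, f (swapSecondFourth z) = f z := fun z => by
    have : boxF r (swapSecondFourth z) = boxF r z := by
      simp only [boxF, boxZ4, swapSecondFourth]; ring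
    simp only [hf, this]
    simp only [swapSecondFourth]
  have i3 : IntegrableOn (fun z => z.2.2 * f z) boxDelta := by
    simpa only [f13] using! integrableOn_comp_of_involutive involutive_swapFirstThird
      measurePreserving_swapFirstThird preimage_swapFirstThird i1
  have i4 : IntegrableOn (fun z => boxZ4 z * f z) boxDelta := by
    simpa only [f24] using! integrableOn_comp_of_involutive involutive_swapSecondFourth
      measurePreserving_swapSecondFourth preimage_swapSecondFourth i2
  have e13 : ∫ z in boxDelta, z.2.2 * f z = ∫ z in boxDelta, z.1 * f z := by
    simpa only [f13] using! setIntegral_comp_of_involutive involutive_swapFirstThird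
      measurePreserving_swapFirstThird preimage_swapFirstThird (fun z => z.1 * f z)
  have e24 : ∫ z in boxDelta, boxZ4 z * f z = ∫ z in boxDelta, z.2.1 * f z := by
    simpa only [f24] using! setIntegral_comp_of_involutive involutive_swapSecondFourth
      measurePreserving_swapSecondFourth preimage_swapSecondFourth (fun z => z.2.1 * f z)
  have g1 : (fun z : ℝ × ℝ × ℝ => z.1 ^ 2 * z.2.2 * boxF r z ^ (-(3 + ε))) =
      fun z => z.1 * f z := by
    funext z; simp only [hf]; ring
  have g2 : (fun z : ℝ × ℝ × ℝ => z.1 * z.2.1 * z.2.2 * boxF r z ^ (-(3 + ε))) =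
      fun z => z.2.1 * f z := by
    funext z; simp only [hf]; ring
  rw [g1, g2]
  refine ⟨i0, i1, i2, ?_⟩
  have hsum : ∀ z, f z = (z.1 * f z + z.2.2 * f z) + (z.2.1 * f z + boxZ4 z * f z) := fun z => by
    unfold boxZ4; ring
  calc ∫ z in boxDelta, f z
      = ∫ z in boxDelta, ((z.1 * f z + z.2.2 * f z) + (z.2.1 * f z + boxZ4 z * f z)) :=
        integral_congr_ae (Filter.Eventually.of_forall hsum)
    _ = _ := by
        rw [integral_add (by exact i1.add i3) (by exact i2.add i4), integral_add i1 i3,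
          integral_add i2 i4, e13, e24]
        ring
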